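/- Let μ > 0, 1 < p < ∞, σ > 1/p − 1, λ = (μ+σ+1)/2, and let F_σ be the integral operator F_σ φ(s) = μ ∫₀¹ (1−t)^σ ₂F₁(λ,λ;μ;st) φ(t) t^{μ−1} dt. Then F_σ is bounded on L^p_μ(0,1) with operator norm at most (Γ(μ+1)/Γ(λ)²) Γ(1/p) Γ(σ + 1 − 1/p). -/

import Mathlib

open MeasureTheory Real Set ENNReal

/-- The real Gauss hypergeometric function `₂F₁(a, b; c; x)`, defined by its power
series. -/
noncomputable def hyp2F1 (a b c x : ℝ) : ℝ :=
  ∑' k : ℕ, ((ascPochhammer ℝ k).eval a * (ascPochhammer ℝ k).eval b /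
    ((ascPochhammer ℝ k).eval c * (k.factorial : ℝ))) * x ^ k

/-- The weighted measure `dμ(t) = μ t^(μ-1) dt` on `(0, 1)`, so that
`L^p_μ(0,1) = L^p` of this measure. -/
noncomputable def wMeasure (μ : ℝ) : Measure ℝ :=
  (volume.restrict (Ioo (0:ℝ) 1)).withDensity fun t => ENNReal.ofReal (μ * t ^ (μ - 1))

/-- The integral operator `F_σ φ(s) = μ ∫₀¹ (1-t)^σ ₂F₁(λ,λ;μ;st) φ(t) t^(μ-1) dt`,
acting on non-negative functions (which determines its norm on `L^p_μ(0,1)`, the kernel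
being non-negative). -/
noncomputable def Fop (μ σ lam : ℝ) (f : ℝ → ℝ≥0∞) (s : ℝ) : ℝ≥0∞ :=
  ∫⁻ t, ENNReal.ofReal ((1 - t) ^ σ * hyp2F1 lam lam μ (s * t)) * f t ∂(wMeasure μ)


/-- The **Schur test** on `L^p` for a non-negative kernel and a single test function `u`. -/
theorem lintegral_rpow_kernel_le_of_schur {α : Type*} [MeasurableSpace α] {ν : Measure α}
    [SFinite ν] {p q : ℝ} (hpq : p.HolderConjugate q) {K : α → α → ℝ≥0∞}
    (hK : Measurable (Function.uncurry K)) {u : α → ℝ≥0∞} (hu : Measurable u)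
    (hu0 : ∀ᵐ t ∂ν, u t ≠ 0) (hutop : ∀ᵐ t ∂ν, u t ≠ ⊤) {C : ℝ≥0∞}
    (hrow : ∀ᵐ s ∂ν, ∫⁻ t, K s t * u t ^ q ∂ν ≤ C * u s ^ q)
    (hcol : ∀ᵐ t ∂ν, ∫⁻ s, K s t * u s ^ p ∂ν ≤ C * u t ^ p)
    {f : α → ℝ≥0∞} (hf : Measurable f) :
    ∫⁻ s, (∫⁻ t, K s t * f t ∂ν) ^ p ∂ν ≤ C ^ p * ∫⁻ t, f t ^ p ∂ν := by
  have hp := hpq.pos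
  have hq := hpq.symm.pos
  have hKs (s : α) : Measurable (K s) := hK.comp measurable_prodMk_left
  have hKt (t : α) : Measurable fun s => K s t := hK.comp measurable_prodMk_right
  have holder : ∀ᵐ s ∂ν, (∫⁻ t, K s t * f t ∂ν) ^ p ≤
      C ^ (p / q) * ∫⁻ t, u s ^ p * (K s t * ((u t)⁻¹ * f t) ^ p) ∂ν := by
    filter_upwards [hrow] with s hs
    have split : ∫⁻ t, K s t * f t ∂ν =
        ∫⁻ t, ((fun t => K s t ^ (1 / p) * ((u t)⁻¹ * f t)) *
          (fun t => K s t ^ (1 / q) * u t)) t ∂ν := by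
      refine lintegral_congr_ae ?_
      filter_upwards [hu0, hutop] with t h0 htop
      have hKpq : K s t ^ (1 / p) * K s t ^ (1 / q) = K s t := by
        rw [← ENNReal.rpow_add_of_nonneg _ _ (by positivity) (by positivity), one_div, one_div,
          hpq.inv_add_inv_eq_one, ENNReal.rpow_one]
      calc K s t * f t
          = (K s t ^ (1 / p) * K s t ^ (1 / q)) * ((u t)⁻¹ * u t) * f t := by
            rw [hKpq, ENNReal.inv_mul_cancel h0 htop, mul_one]
        _ = _ := by simp only [Pi.mul_apply]; ring
    have hle : ∫⁻ t, K s t * f t ∂ν ≤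
        (∫⁻ t, K s t * ((u t)⁻¹ * f t) ^ p ∂ν) ^ (1 / p) * (C * u s ^ q) ^ (1 / q) := by
      have hpow {r : ℝ} (hr : 0 < r) (x y : ℝ≥0∞) : (x ^ (1 / r) * y) ^ r = x * y ^ r := by
        rw [ENNReal.mul_rpow_of_nonneg _ _ hr.le, ← ENNReal.rpow_mul,
          one_div_mul_cancel hr.ne', ENNReal.rpow_one]
      have key := ENNReal.lintegral_mul_le_Lp_mul_Lq ν hpq
        (f := fun t => K s t ^ (1 / p) * ((u t)⁻¹ * f t)) (g := fun t => K s t ^ (1 / q) * u t)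
        (((hKs s).pow_const _).mul (hu.inv.mul hf)).aemeasurable
        (((hKs s).pow_const _).mul hu).aemeasurable
      simp only [hpow hp, hpow hq] at key
      rw [split]
      refine key.trans ?_
      gcongr
    calc (∫⁻ t, K s t * f t ∂ν) ^ p
        ≤ ((∫⁻ t, K s t * ((u t)⁻¹ * f t) ^ p ∂ν) ^ (1 / p) * (C * u s ^ q) ^ (1 / q)) ^ p := by
          gcongr
      _ = C ^ (p / q) * (u s ^ p * ∫⁻ t, K s t * ((u t)⁻¹ * f t) ^ p ∂ν) := by
          rw [ENNReal.mul_rpow_of_nonneg _ _ hp.le, ← ENNReal.rpow_mul,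
            one_div_mul_cancel hp.ne', ENNReal.rpow_one, ← ENNReal.rpow_mul,
            ENNReal.mul_rpow_of_nonneg _ _ (by positivity), ← ENNReal.rpow_mul,
            show 1 / q * p = p / q by ring, show q * (p / q) = p by field_simp]
          ring
      _ = _ := by
          rw [lintegral_const_mul]
          exact (hKs s).mul ((hu.inv.mul hf).pow_const _)
  have hmeas : Measurable (Function.uncurry fun s t =>
      u s ^ p * (K s t * ((u t)⁻¹ * f t) ^ p)) :=
    ((hu.comp measurable_fst).pow_const _).mul
      (hK.mul (((hu.inv.mul hf).pow_const _).comp measurable_snd))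
  calc ∫⁻ s, (∫⁻ t, K s t * f t ∂ν) ^ p ∂ν
      ≤ ∫⁻ s, C ^ (p / q) * ∫⁻ t, u s ^ p * (K s t * ((u t)⁻¹ * f t) ^ p) ∂ν ∂ν :=
        lintegral_mono_ae holder
    _ = C ^ (p / q) * ∫⁻ t, ∫⁻ s, u s ^ p * (K s t * ((u t)⁻¹ * f t) ^ p) ∂ν ∂ν := by
        rw [lintegral_const_mul _ hmeas.lintegral_prod_right,
          lintegral_lintegral_swap hmeas.aemeasurable]
    _ ≤ C ^ (p / q) * ∫⁻ t, C * f t ^ p ∂ν := by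
        refine mul_le_mul_right (lintegral_mono_ae ?_) _
        filter_upwards [hcol, hu0, hutop] with t ht h0 htop
        calc ∫⁻ s, u s ^ p * (K s t * ((u t)⁻¹ * f t) ^ p) ∂ν
            = (∫⁻ s, K s t * u s ^ p ∂ν) * ((u t)⁻¹ * f t) ^ p := by
              rw [← lintegral_mul_const _ (by fun_prop)]
              exact lintegral_congr fun s => by ring
          _ ≤ C * u t ^ p * ((u t)⁻¹ * f t) ^ p := by gcongr
          _ = C * f t ^ p := by
              rw [mul_assoc, ← ENNReal.mul_rpow_of_nonneg _ _ hp.le, ← mul_assoc (u t),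
                ENNReal.mul_inv_cancel h0 htop, one_mul]
    _ = C ^ p * ∫⁻ t, f t ^ p ∂ν := by
        rw [lintegral_const_mul _ (hf.pow_const _), ← mul_assoc]
        congr 1
        nth_rw 2 [← ENNReal.rpow_one C]
        rw [← ENNReal.rpow_add_of_nonneg _ _ (by positivity) zero_le_one,
          hpq.div_conj_eq_sub_one, sub_add_cancel]

theorem Gamma_add_natCast_eq_ascPochhammer_mul {a : ℝ} (ha : 0 < a) (k : ℕ) :
    Real.Gamma (a + k) = (ascPochhammer ℝ k).eval a * Real.Gamma a := by
  induction k with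
  | zero => simp
  | succ k ih =>
    rw [ascPochhammer_succ_eval, Nat.cast_succ, ← add_assoc,
      Real.Gamma_add_one (by positivity), ih]
    ring

/-- Midpoint log-convexity of the Gamma function. -/
theorem Gamma_sq_le_Gamma_mul_Gamma {a b c : ℝ} (ha : 0 < a) (hb : 0 < b)
    (hc : a + b = 2 * c) : Real.Gamma c ^ 2 ≤ Real.Gamma a * Real.Gamma b := by
  have h := Real.Gamma_mul_add_mul_le_rpow_Gamma_mul_rpow_Gamma ha hb
    (by norm_num : (0 : ℝ) < 1 / 2) (by norm_num : (0 : ℝ) < 1 / 2) (by norm_num)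
  rw [show 1 / 2 * a + 1 / 2 * b = c by linarith, ← Real.sqrt_eq_rpow, ← Real.sqrt_eq_rpow,
    ← Real.sqrt_mul (Real.Gamma_pos_of_pos ha).le] at h
  exact (Real.le_sqrt' (Real.Gamma_pos_of_pos (by linarith))).mp h

theorem lintegral_rpow_mul_exp_neg_mul_Ioi {a r : ℝ} (ha : 0 < a) (hr : 0 < r) :
    ∫⁻ t in Ioi (0 : ℝ), ENNReal.ofReal (t ^ (a - 1) * Real.exp (-(r * t))) =
      ENNReal.ofReal ((1 / r) ^ a * Real.Gamma a) := by
  have key := Real.integral_rpow_mul_exp_neg_mul_Ioi ha hr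
  have hpos := Real.Gamma_pos_of_pos ha
  rw [← key, ofReal_integral_eq_lintegral_ofReal
    (.of_integral_ne_zero (by rw [key]; positivity))]
  refine ae_restrict_of_forall_mem measurableSet_Ioi fun t (ht : 0 < t) => ?_
  positivity

/-- The binomial series of `(1 - x) ^ (-b)`. -/
theorem tsum_ofReal_Gamma_add_natCast_div_factorial {b x : ℝ} (hb : 0 < b) (hx0 : 0 ≤ x)
    (hx1 : x < 1) :
    ∑' k : ℕ, ENNReal.ofReal (Real.Gamma (b + k) / k.factorial * x ^ k) =
      ENNReal.ofReal (Real.Gamma b * (1 - x) ^ (-b)) := by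
  have term (k : ℕ) : ENNReal.ofReal (Real.Gamma (b + k) / k.factorial * x ^ k) =
      ∫⁻ t in Ioi (0 : ℝ), ENNReal.ofReal (x ^ k / k.factorial) *
        ENNReal.ofReal (t ^ (b + k - 1) * Real.exp (-(1 * t))) := by
    rw [lintegral_const_mul _ (by fun_prop),
      lintegral_rpow_mul_exp_neg_mul_Ioi (by positivity) one_pos,
      ← ENNReal.ofReal_mul (by positivity), div_one, Real.one_rpow]
    ring_nf
  simp_rw [term]
  rw [← lintegral_tsum fun k => by fun_prop]
  have hsum : ∀ t ∈ Ioi (0 : ℝ), ∑' k : ℕ, ENNReal.ofReal (x ^ k / k.factorial) *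
      ENNReal.ofReal (t ^ (b + k - 1) * Real.exp (-(1 * t))) =
      ENNReal.ofReal (t ^ (b - 1) * Real.exp (-((1 - x) * t))) := by
    intro t (ht : 0 < t)
    have hexp : HasSum (fun k : ℕ => t ^ (b - 1) * Real.exp (-t) * ((x * t) ^ k / k.factorial))
        (t ^ (b - 1) * Real.exp (-t) * Real.exp (x * t)) := by
      rw [Real.exp_eq_exp_ℝ]
      exact (NormedSpace.expSeries_div_hasSum_exp (x * t)).mul_left _
    rw [show t ^ (b - 1) * Real.exp (-((1 - x) * t)) =
        t ^ (b - 1) * Real.exp (-t) * Real.exp (x * t) by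
      rw [mul_assoc, ← Real.exp_add]; ring_nf, ← hexp.tsum_eq,
      ENNReal.ofReal_tsum_of_nonneg (fun k => by positivity) hexp.summable]
    refine tsum_congr fun k => ?_
    rw [← ENNReal.ofReal_mul (by positivity), show b + k - 1 = b - 1 + k by ring,
      Real.rpow_add_natCast ht.ne']
    ring_nf
  rw [setLIntegral_congr_fun measurableSet_Ioi hsum,
    lintegral_rpow_mul_exp_neg_mul_Ioi hb (by linarith), one_div,
    Real.inv_rpow (by linarith), ← Real.rpow_neg (by linarith), mul_comm]

theorem lintegral_beta {a b : ℝ} (ha : 0 < a) (hb : 0 < b) :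
    ∫⁻ t in Ioo (0 : ℝ) 1, ENNReal.ofReal (t ^ (a - 1) * (1 - t) ^ (b - 1)) =
      ENNReal.ofReal (ProbabilityTheory.beta a b) := by
  have hB := ProbabilityTheory.beta_pos ha hb
  have h := ProbabilityTheory.lintegral_betaPDF_eq_one ha hb
  rw [ProbabilityTheory.lintegral_betaPDF] at h
  simp_rw [mul_assoc, ENNReal.ofReal_mul (one_div_pos.2 hB).le] at h
  rw [lintegral_const_mul _ (by fun_prop)] at h
  rw [← mul_one (ENNReal.ofReal (ProbabilityTheory.beta a b)), ← h, ← mul_assoc,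
    ← ENNReal.ofReal_mul hB.le, mul_one_div_cancel hB.ne', ENNReal.ofReal_one, one_mul]

theorem ae_wMeasure_mem_Ioo (μ : ℝ) : ∀ᵐ t ∂wMeasure μ, t ∈ Ioo (0 : ℝ) 1 :=
  (withDensity_absolutelyContinuous _ _).ae_le (ae_restrict_mem measurableSet_Ioo)

theorem lintegral_wMeasure_one_sub_rpow_mul_pow {μ a : ℝ} (hμ : 0 < μ) (ha : 0 < a) (k : ℕ) :
    ∫⁻ t, ENNReal.ofReal ((1 - t) ^ (a - 1) * t ^ k) ∂wMeasure μ =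
      ENNReal.ofReal (μ * ProbabilityTheory.beta (μ + k) a) := by
  rw [wMeasure, lintegral_withDensity_eq_lintegral_mul _ (by fun_prop) (by fun_prop),
    ENNReal.ofReal_mul hμ.le, ← lintegral_beta (by positivity) ha,
    ← lintegral_const_mul _ (by fun_prop)]
  refine setLIntegral_congr_fun measurableSet_Ioo fun t ht => ?_
  have ht0 := ht.1
  simp only [Pi.mul_apply]
  rw [← ENNReal.ofReal_mul (by positivity), ← ENNReal.ofReal_mul hμ.le,
    show μ + k - 1 = μ - 1 + k by ring, Real.rpow_add_natCast ht0.ne']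
  ring_nf

/-- The `ℝ≥0∞`-valued sum of the series defining `₂F₁(l, l; c; x)`. -/
noncomputable def hyp2F1ENNReal (l c x : ℝ) : ℝ≥0∞ :=
  ∑' k : ℕ, ENNReal.ofReal (((ascPochhammer ℝ k).eval l * (ascPochhammer ℝ k).eval l /
    ((ascPochhammer ℝ k).eval c * (k.factorial : ℝ))) * x ^ k)

@[fun_prop]
theorem measurable_hyp2F1ENNReal (l c : ℝ) : Measurable (hyp2F1ENNReal l c) :=
  Measurable.tsum fun _ => by fun_prop

theorem ofReal_hyp2F1_le {l c x : ℝ} (hl : 0 < l) (hc : 0 < c) (hx : 0 ≤ x) :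
    ENNReal.ofReal (hyp2F1 l l c x) ≤ hyp2F1ENNReal l c x := by
  unfold hyp2F1 hyp2F1ENNReal
  by_cases h : Summable fun k : ℕ => ((ascPochhammer ℝ k).eval l * (ascPochhammer ℝ k).eval l /
    ((ascPochhammer ℝ k).eval c * (k.factorial : ℝ))) * x ^ k
  · refine (ENNReal.ofReal_tsum_of_nonneg (fun k => ?_) h).le
    have := ascPochhammer_pos k l hl
    have := ascPochhammer_pos k c hc
    positivity
  · simp [tsum_eq_zero_of_not_summable h]

theorem hyp2F1_coeff_mul_beta_le {μ l a b : ℝ} (hμ : 0 < μ) (ha : 0 < a) (hb : 0 < b)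
    (hl : 2 * l = μ + a + b) (k : ℕ) :
    (ascPochhammer ℝ k).eval l * (ascPochhammer ℝ k).eval l /
        ((ascPochhammer ℝ k).eval μ * (k.factorial : ℝ)) *
        (μ * ProbabilityTheory.beta (μ + k) a) ≤
      Real.Gamma (μ + 1) / Real.Gamma l ^ 2 * Real.Gamma a *
        (Real.Gamma (b + k) / k.factorial) := by
  have hl0 : 0 < l := by linarith
  have hGl := Real.Gamma_pos_of_pos hl0
  have hGμ := Real.Gamma_pos_of_pos hμ
  have hGa := Real.Gamma_pos_of_pos ha
  have hP := ascPochhammer_pos k μ hμ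
  have hG : 0 < Real.Gamma (μ + k + a) := Real.Gamma_pos_of_pos (by positivity)
  have hconv : Real.Gamma (l + k) ^ 2 ≤ Real.Gamma (b + k) * Real.Gamma (μ + k + a) :=
    Gamma_sq_le_Gamma_mul_Gamma (by positivity) (by positivity) (by linarith)
  rw [Gamma_add_natCast_eq_ascPochhammer_mul hl0] at hconv
  rw [ProbabilityTheory.beta, Gamma_add_natCast_eq_ascPochhammer_mul hμ,
    Real.Gamma_add_one hμ.ne']
  have hfac : (0 : ℝ) < k.factorial := by positivity
  calc _ = μ * Real.Gamma μ * Real.Gamma a / (Real.Gamma l ^ 2 * k.factorial) *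
        (((ascPochhammer ℝ k).eval l * Real.Gamma l) ^ 2 / Real.Gamma (μ + k + a)) := by
        field_simp
    _ ≤ μ * Real.Gamma μ * Real.Gamma a / (Real.Gamma l ^ 2 * k.factorial) *
        Real.Gamma (b + k) := by
        gcongr
        rwa [div_le_iff₀ hG]
    _ = _ := by field_simp

theorem lintegral_one_sub_rpow_mul_hyp2F1ENNReal_le {μ l a b x : ℝ} (hμ : 0 < μ) (ha : 0 < a)
    (hb : 0 < b) (hl : 2 * l = μ + a + b) (hx : x ∈ Ioo (0 : ℝ) 1) :
    ∫⁻ t, ENNReal.ofReal ((1 - t) ^ (a - 1)) * hyp2F1ENNReal l μ (x * t) ∂wMeasure μ ≤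
      ENNReal.ofReal (Real.Gamma (μ + 1) / Real.Gamma l ^ 2 * Real.Gamma a * Real.Gamma b) *
        ENNReal.ofReal ((1 - x) ^ (-b)) := by
  obtain ⟨hx0, hx1⟩ := hx
  have hl0 : 0 < l := by linarith
  have hGl := Real.Gamma_pos_of_pos hl0
  have hGμ : 0 < Real.Gamma (μ + 1) := Real.Gamma_pos_of_pos (by linarith)
  have hGa := Real.Gamma_pos_of_pos ha
  have hGb := Real.Gamma_pos_of_pos hb
  set c : ℕ → ℝ := fun k => (ascPochhammer ℝ k).eval l * (ascPochhammer ℝ k).eval l /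
    ((ascPochhammer ℝ k).eval μ * (k.factorial : ℝ)) with hc
  have hc0 (k : ℕ) : 0 ≤ c k := by
    have := ascPochhammer_pos k l hl0
    have := ascPochhammer_pos k μ hμ
    positivity
  calc ∫⁻ t, ENNReal.ofReal ((1 - t) ^ (a - 1)) * hyp2F1ENNReal l μ (x * t) ∂wMeasure μ
      = ∫⁻ t, ∑' k : ℕ, ENNReal.ofReal (c k * x ^ k) *
          ENNReal.ofReal ((1 - t) ^ (a - 1) * t ^ k) ∂wMeasure μ := by
        refine lintegral_congr_ae ?_
        filter_upwards [ae_wMeasure_mem_Ioo μ] with t ht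
        have h1t : 0 < 1 - t := sub_pos.2 ht.2
        rw [hyp2F1ENNReal, ← ENNReal.tsum_mul_left]
        refine tsum_congr fun k => ?_
        have := hc0 k
        rw [← ENNReal.ofReal_mul (by positivity), ← ENNReal.ofReal_mul (by positivity), mul_pow]
        simp only [hc]
        ring_nf
    _ = ∑' k : ℕ, ENNReal.ofReal (c k * x ^ k) *
          ENNReal.ofReal (μ * ProbabilityTheory.beta (μ + k) a) := by
        rw [lintegral_tsum fun k => by fun_prop]
        refine tsum_congr fun k => ?_
        rw [lintegral_const_mul _ (by fun_prop), lintegral_wMeasure_one_sub_rpow_mul_pow hμ ha]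
    _ ≤ ∑' k : ℕ, ENNReal.ofReal (Real.Gamma (μ + 1) / Real.Gamma l ^ 2 * Real.Gamma a) *
          ENNReal.ofReal (Real.Gamma (b + k) / k.factorial * x ^ k) := by
        refine ENNReal.tsum_le_tsum fun k => ?_
        have := hc0 k
        rw [← ENNReal.ofReal_mul (by positivity), ← ENNReal.ofReal_mul (by positivity)]
        refine ENNReal.ofReal_le_ofReal ?_
        rw [mul_right_comm, ← mul_assoc (_ * Real.Gamma a)]
        exact mul_le_mul_of_nonneg_right (hyp2F1_coeff_mul_beta_le hμ ha hb hl k) (by positivity)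
    _ = _ := by
        rw [ENNReal.tsum_mul_left, tsum_ofReal_Gamma_add_natCast_div_factorial hb hx0.le hx1,
          ← ENNReal.ofReal_mul (by positivity), ← ENNReal.ofReal_mul (by positivity)]
        ring_nf

/-- For `1 < p < ∞` and `σ > 1/p - 1`, the operator `F_σ` is bounded on `L^p_μ(0,1)`
with operator norm at most `(Γ(μ+1)/Γ(λ)²) Γ(1/p) Γ(σ+1-1/p)`, where `λ = (μ+σ+1)/2`. -/
theorem Fop_lp_norm_upper (μ σ lam p : ℝ) (hμ : 0 < μ) (hp : 1 < p)
    (hσ : 1 / p - 1 < σ) (hlam : lam = (μ + σ + 1) / 2) :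
    ∀ f : ℝ → ℝ≥0∞, Measurable f →
      (∫⁻ s, Fop μ σ lam f s ^ p ∂(wMeasure μ)) ^ (1 / p) ≤
        ENNReal.ofReal (Real.Gamma (μ + 1) / Real.Gamma lam ^ 2 *
            Real.Gamma (1 / p) * Real.Gamma (σ + 1 - 1 / p)) *
          (∫⁻ t, f t ^ p ∂(wMeasure μ)) ^ (1 / p) := by
  intro f hf
  have hp0 : 0 < p := by linarith
  have hpq := Real.HolderConjugate.conjExponent hp
  set q := p.conjExponent
  have hq0 : 0 < q := hpq.symm.pos
  have hpinv : 0 < 1 / p := by positivity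
  have hinv : 1 / q = 1 - 1 / p := by
    have := hpq.inv_add_inv_eq_one
    simp only [one_div]
    linarith
  have ha : 0 < σ + 1 - 1 / p := by linarith
  have hl0 : 0 < lam := by linarith
  set C := ENNReal.ofReal (Real.Gamma (μ + 1) / Real.Gamma lam ^ 2 *
    Real.Gamma (1 / p) * Real.Gamma (σ + 1 - 1 / p)) with hC
  set K : ℝ → ℝ → ℝ≥0∞ := fun s t =>
    ENNReal.ofReal ((1 - t) ^ σ) * hyp2F1ENNReal lam μ (s * t)
  have hK : Measurable (Function.uncurry K) := by
    simp only [K, Function.uncurry_def]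
    fun_prop
  set u : ℝ → ℝ≥0∞ := fun t => ENNReal.ofReal ((1 - t) ^ (-(1 / (p * q)))) with hu
  have hu_rpow {t r : ℝ} (ht : t ∈ Ioo (0 : ℝ) 1) :
      u t ^ r = ENNReal.ofReal ((1 - t) ^ (-(1 / (p * q)) * r)) := by
    have h1t : 0 < 1 - t := sub_pos.2 ht.2
    rw [hu, ENNReal.ofReal_rpow_of_pos (by positivity), ← Real.rpow_mul h1t.le]
  have hexp_q : -(1 / (p * q)) * q = -(1 / p) := by field_simp
  have hexp_p : -(1 / (p * q)) * p = -(1 / q) := by field_simp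
  have hrow : ∀ᵐ s ∂wMeasure μ, ∫⁻ t, K s t * u t ^ q ∂wMeasure μ ≤ C * u s ^ q := by
    filter_upwards [ae_wMeasure_mem_Ioo μ] with s hs
    rw [hu_rpow hs, hexp_q, hC, mul_right_comm (_ / _)]
    refine le_of_eq_of_le (lintegral_congr_ae ?_)
      (lintegral_one_sub_rpow_mul_hyp2F1ENNReal_le hμ ha hpinv (by rw [hlam]; ring) hs)
    filter_upwards [ae_wMeasure_mem_Ioo μ] with t ht
    have h1t : 0 < 1 - t := sub_pos.2 ht.2
    rw [hu_rpow ht, hexp_q, mul_right_comm, ← ENNReal.ofReal_mul (by positivity),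
      ← Real.rpow_add h1t]
    ring_nf
  have hcol : ∀ᵐ t ∂wMeasure μ, ∫⁻ s, K s t * u s ^ p ∂wMeasure μ ≤ C * u t ^ p := by
    filter_upwards [ae_wMeasure_mem_Ioo μ] with t ht
    have h1t : 0 < 1 - t := sub_pos.2 ht.2
    calc ∫⁻ s, K s t * u s ^ p ∂wMeasure μ
        = ENNReal.ofReal ((1 - t) ^ σ) * ∫⁻ s, ENNReal.ofReal ((1 - s) ^ (1 / p - 1)) *
            hyp2F1ENNReal lam μ (t * s) ∂wMeasure μ := by
          rw [← lintegral_const_mul _ (by fun_prop)]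
          refine lintegral_congr_ae ?_
          filter_upwards [ae_wMeasure_mem_Ioo μ] with s hs
          rw [hu_rpow hs, hexp_p, hinv, neg_sub, mul_comm t s]
          ring
      _ ≤ ENNReal.ofReal ((1 - t) ^ σ) *
            (C * ENNReal.ofReal ((1 - t) ^ (-(σ + 1 - 1 / p)))) := by
          gcongr
          exact lintegral_one_sub_rpow_mul_hyp2F1ENNReal_le hμ hpinv ha (by rw [hlam]; ring) ht
      _ = C * u t ^ p := by
          rw [hu_rpow ht, hexp_p, hinv, mul_left_comm, ← ENNReal.ofReal_mul (by positivity),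
            ← Real.rpow_add h1t]
          ring_nf
  have hFop : ∀ᵐ s ∂wMeasure μ, Fop μ σ lam f s ≤ ∫⁻ t, K s t * f t ∂wMeasure μ := by
    filter_upwards [ae_wMeasure_mem_Ioo μ] with s hs
    refine lintegral_mono_ae ?_
    filter_upwards [ae_wMeasure_mem_Ioo μ] with t ht
    have h1t : 0 < 1 - t := sub_pos.2 ht.2
    rw [ENNReal.ofReal_mul (by positivity)]
    simp only [K]
    gcongr
    exact ofReal_hyp2F1_le hl0 hμ (mul_pos hs.1 ht.1).le
  have hu0 : ∀ᵐ t ∂wMeasure μ, u t ≠ 0 := by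
    filter_upwards [ae_wMeasure_mem_Ioo μ] with t ht
    exact (ENNReal.ofReal_pos.2 (Real.rpow_pos_of_pos (sub_pos.2 ht.2) _)).ne'
  have hSFinite : SFinite (wMeasure μ) := by
    unfold wMeasure
    infer_instance
  calc (∫⁻ s, Fop μ σ lam f s ^ p ∂wMeasure μ) ^ (1 / p)
      ≤ (C ^ p * ∫⁻ t, f t ^ p ∂wMeasure μ) ^ (1 / p) := by
        gcongr
        refine (lintegral_mono_ae ?_).trans (lintegral_rpow_kernel_le_of_schur hpq hK
          (by fun_prop) hu0 (ae_of_all _ fun t => ENNReal.ofReal_ne_top) hrow hcol hf)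
        filter_upwards [hFop] with s hs
        gcongr
    _ = C * (∫⁻ t, f t ^ p ∂wMeasure μ) ^ (1 / p) := by
        rw [ENNReal.mul_rpow_of_nonneg _ _ hpinv.le, ← ENNReal.rpow_mul,
          mul_one_div_cancel hp0.ne', ENNReal.rpow_one]
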